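/- Let G be a finite connected simple graph that is k-regular with k ≥ 2. Then gon(G) ≥ (h(G)/(k + h(G)))·|V(G)|. -/

import Mathlib

open SimpleGraph Finset

namespace GraphGonality

variable {V : Type*}

/-- The degree of a divisor: the sum of its values. -/
def degD [Fintype V] (D : V → ℤ) : ℤ := ∑ v, D v

/-- A divisor is effective if it is nonnegative at every vertex. -/
def Effective (D : V → ℤ) : Prop := ∀ v, 0 ≤ D v

/-- The graph Laplacian applied to an integer vector. -/
def lapply (G : SimpleGraph V) [Fintype V] [DecidableEq V] [DecidableRel G.Adj]
    (x : V → ℤ) : V → ℤ :=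
  fun v => (G.degree v : ℤ) * x v - ∑ w ∈ G.neighborFinset v, x w

/-- Two divisors are linearly equivalent if their difference lies in the image of the
Laplacian acting on `ℤ^V`. -/
def LinEquiv (G : SimpleGraph V) [Fintype V] [DecidableEq V] [DecidableRel G.Adj]
    (D D' : V → ℤ) : Prop :=
  ∃ x : V → ℤ, D - D' = lapply G x

/-- A divisor has positive rank if, for every vertex `v`, the divisor `D - 1_v` is
linearly equivalent to an effective divisor. -/
def PosRank (G : SimpleGraph V) [Fintype V] [DecidableEq V] [DecidableRel G.Adj]
    (D : V → ℤ) : Prop :=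
  ∀ v : V, ∃ E : V → ℤ, Effective E ∧
    LinEquiv G (fun w => D w - if w = v then 1 else 0) E

/-- The gonality of a graph: the smallest degree of a divisor of positive rank. -/
noncomputable def gonality (G : SimpleGraph V) [Fintype V] [DecidableEq V]
    [DecidableRel G.Adj] : ℤ :=
  sInf {d : ℤ | ∃ D : V → ℤ, PosRank G D ∧ degD D = d}

/-- The support of a divisor. -/
def suppD (D : V → ℤ) : Set V := {v | 0 < D v}

/-- The edge boundary of a set of vertices: edges with exactly one endpoint in `U`. -/
def edgeBoundary (G : SimpleGraph V) (U : Set V) : Set (Sym2 V) :=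
  {e | e ∈ G.edgeSet ∧ ∃ a b, e = s(a, b) ∧ a ∈ U ∧ b ∉ U}

/-- The Cheeger constant of a graph. -/
noncomputable def cheeger (G : SimpleGraph V) [Fintype V] : ℝ :=
  sInf {r : ℝ | ∃ U : Set V, U.Nonempty ∧ (U.ncard : ℝ) ≤ (Fintype.card V : ℝ) / 2 ∧
    r = (edgeBoundary G U).ncard / U.ncard}

/-- The `u`-Cheeger constant of a graph. -/
noncomputable def cheegerU (G : SimpleGraph V) [Fintype V] (u : ℝ) : ℝ :=
  sInf {r : ℝ | ∃ U : Set V, U.Nonempty ∧ (U.ncard : ℝ) ≤ u * (Fintype.card V : ℝ) ∧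
    r = (edgeBoundary G U).ncard / U.ncard}

/-- Every connected component of the induced subgraph on the complement of the support
of `D` has at most `u * |V|` vertices. -/
def ComponentsSmall (G : SimpleGraph V) [Fintype V] (D : V → ℤ) (u : ℝ) : Prop :=
  ∀ c : (G.induce (suppD D)ᶜ).ConnectedComponent,
    (c.supp.ncard : ℝ) ≤ u * (Fintype.card V : ℝ)

/-- `B_u(G)`: the smallest degree of an effective divisor all of whose complementary
components have size at most `u * |V|`. -/
noncomputable def Bu (G : SimpleGraph V) [Fintype V] (u : ℝ) : ℤ :=
  sInf {d : ℤ | ∃ D : V → ℤ, Effective D ∧ ComponentsSmall G D u ∧ degD D = d}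


section Laplacian

variable [Fintype V] [DecidableEq V] (G : SimpleGraph V) [DecidableRel G.Adj]

lemma lapply_eq_sum_sub (x : V → ℤ) (v : V) :
    lapply G x v = ∑ w ∈ G.neighborFinset v, (x v - x w) := by
  simp [lapply, Finset.sum_sub_distrib]

lemma lapply_add (x y : V → ℤ) : lapply G (x + y) = lapply G x + lapply G y := by
  ext v
  simp only [lapply_eq_sum_sub, Pi.add_apply, ← Finset.sum_add_distrib]
  exact Finset.sum_congr rfl fun _ _ => by ring

lemma lapply_sub (x y : V → ℤ) : lapply G (x - y) = lapply G x - lapply G y := by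
  rw [eq_sub_iff_add_eq, ← lapply_add, sub_add_cancel]

lemma degD_lapply (x : V → ℤ) : degD (lapply G x) = 0 := by
  have h : ∑ v, ∑ w ∈ G.neighborFinset v, (x v - x w)
      = ∑ w, ∑ v ∈ G.neighborFinset w, (x v - x w) :=
    Finset.sum_comm' fun v w => by simp [G.adj_comm]
  have h' : degD (lapply G x) = -degD (lapply G x) := by
    conv_lhs => simp only [degD, lapply_eq_sum_sub, h]
    simp only [degD, lapply_eq_sum_sub, ← Finset.sum_neg_distrib, neg_sub]
  omega

/-- The indicator of a finite set as an integer vector: the script firing `U` once. -/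
def fire (U : Finset V) : V → ℤ := fun v => if v ∈ U then 1 else 0

lemma one_le_lapply_fire {U : Finset V} {a b : V} (hab : G.Adj a b) (ha : a ∈ U) (hb : b ∉ U) :
    1 ≤ lapply G (fire U) a := by
  rw [lapply_eq_sum_sub]
  have h := Finset.single_le_sum (f := fun w => fire U a - fire U w)
    (fun w _ => by simp only [fire, ha]; split_ifs <;> simp_all)
    ((G.mem_neighborFinset a b).2 hab)
  simpa [fire, ha, hb] using h

lemma lapply_fire_nonpos {U : Finset V} {b : V} (hb : b ∉ U) : lapply G (fire U) b ≤ 0 := by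
  rw [lapply_eq_sum_sub]
  exact Finset.sum_nonpos fun w _ => by simp only [fire, hb, if_false]; split_ifs <;> simp

lemma lapply_fire_le_neg_one {U : Finset V} {a b : V} (hab : G.Adj a b) (ha : a ∈ U)
    (hb : b ∉ U) : lapply G (fire U) b ≤ -1 := by
  rw [lapply_eq_sum_sub]
  have h := Finset.single_le_sum (f := fun w => fire U w - fire U b)
    (fun w _ => by simp only [fire, hb, if_false]; split_ifs <;> simp)
    ((G.mem_neighborFinset b a).2 hab.symm)
  simpa [fire, ha, hb] using neg_le_neg h

/-- Firing the set where an integer script attains its maximum costs no vertex of that set more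
than the whole script does. -/
lemma lapply_fire_le {U : Finset V} {x : V → ℤ} {a : V} (ha : a ∈ U) (hle : ∀ w, x w ≤ x a)
    (hlt : ∀ w ∉ U, x w < x a) : lapply G (fire U) a ≤ lapply G x a := by
  simp only [lapply_eq_sum_sub]
  refine Finset.sum_le_sum fun w _ => ?_
  have h₁ := hle w
  by_cases hw : w ∈ U
  · simp [fire, ha, hw, h₁]
  · have h₂ := hlt w hw
    simp only [fire, ha, hw, if_true, if_false]
    omega

end Laplacian

/-- A vertex set that cannot be split into two nonempty parts without edges between them. -/
def Unsplit (G : SimpleGraph V) (B : Finset V) : Prop :=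
  ∀ U : Finset V, (∀ a ∈ B, ∀ b ∈ B, G.Adj a b → a ∈ U → b ∈ U) → (∃ a ∈ B, a ∈ U) → B ⊆ U

lemma Unsplit.union [DecidableEq V] {G : SimpleGraph V} {A B : Finset V} (hA : Unsplit G A)
    (hB : Unsplit G B) (h : ∃ a ∈ A, a ∈ B) : Unsplit G (A ∪ B) := by
  obtain ⟨c, hcA, hcB⟩ := h
  intro U hU ⟨a, ha, haU⟩
  have hUA := hA U fun a ha b hb =>
    hU a (Finset.mem_union_left _ ha) b (Finset.mem_union_left _ hb)
  have hUB := hB U fun a ha b hb =>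
    hU a (Finset.mem_union_right _ ha) b (Finset.mem_union_right _ hb)
  have hcU : c ∈ U := by
    rcases Finset.mem_union.1 ha with ha | ha
    · exact hUA ⟨a, ha, haU⟩ hcA
    · exact hUB ⟨a, ha, haU⟩ hcB
  exact Finset.union_subset (hUA ⟨c, hcA, hcU⟩) (hUB ⟨c, hcB, hcU⟩)

section Cheeger

variable [Fintype V] (G : SimpleGraph V)

lemma cheeger_nonneg : 0 ≤ cheeger G := by
  refine Real.sInf_nonneg ?_
  rintro r ⟨U, -, -, rfl⟩
  positivity

variable [DecidableEq V] [DecidableRel G.Adj]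

lemma ncard_edgeBoundary_le (U : Finset V) :
    (edgeBoundary G (U : Set V)).ncard ≤ ∑ a ∈ U, (G.neighborFinset a \ U).card := by
  have h : edgeBoundary G (U : Set V) ⊆
      ((U.sigma fun a => G.neighborFinset a \ U).image fun p => s(p.1, p.2) :
        Finset (Sym2 V)) := by
    rintro e ⟨he, a, b, rfl, ha, hb⟩
    simp only [Finset.coe_image, Set.mem_image, Finset.mem_coe, Finset.mem_sigma,
      Finset.mem_sdiff, mem_neighborFinset]
    exact ⟨⟨a, b⟩, ⟨ha, he, hb⟩, rfl⟩
  calc (edgeBoundary G (U : Set V)).ncard ≤ _ := Set.ncard_le_ncard h (Finset.finite_toSet _)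
    _ ≤ _ := by
      rw [Set.ncard_coe_finset, ← Finset.card_sigma]
      exact Finset.card_image_le

lemma cheeger_mul_card_le {U : Finset V} (hU : 2 * U.card ≤ Fintype.card V) :
    cheeger G * U.card ≤ ∑ a ∈ U, ((G.neighborFinset a \ U).card : ℝ) := by
  rcases U.eq_empty_or_nonempty with rfl | hne
  · simp
  have hpos : (0 : ℝ) < U.card := by exact_mod_cast hne.card_pos
  have hle : cheeger G ≤ (edgeBoundary G (U : Set V)).ncard / U.card := by
    refine csInf_le ⟨0, ?_⟩ ⟨U, hne, ?_, by rw [Set.ncard_coe_finset]⟩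
    · rintro r ⟨U, -, -, rfl⟩
      positivity
    · rw [Set.ncard_coe_finset, le_div_iff₀ two_pos, mul_comm]
      exact_mod_cast hU
  refine ((le_div_iff₀ hpos).1 hle).trans ?_
  exact_mod_cast ncard_edgeBoundary_le G U

/-- If every unsplit set avoiding `S` has at most half of the vertices, then a union of components
of the complement of `S` sends at least `h(G)` edges per vertex to `S`. -/
lemma cheeger_mul_card_le_sum_inter {S : Finset V}
    (hS : ∀ B : Finset V, Unsplit G B → Disjoint B S → 2 * B.card ≤ Fintype.card V)
    (A : Finset V) (hAS : Disjoint A S)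
    (hA : ∀ a ∈ A, ∀ b, G.Adj a b → b ∈ A ∨ b ∈ S) :
    cheeger G * A.card ≤ ∑ a ∈ A, ((G.neighborFinset a ∩ S).card : ℝ) := by
  induction A using Finset.strongInduction with
  | H A ih =>
    by_cases hun : Unsplit G A
    · refine (cheeger_mul_card_le G (hS A hun hAS)).trans (Finset.sum_le_sum fun a ha => ?_)
      refine Nat.cast_le.2 (Finset.card_le_card fun b hb => ?_)
      rw [Finset.mem_sdiff, mem_neighborFinset] at hb
      exact Finset.mem_inter.2
        ⟨(G.mem_neighborFinset a b).2 hb.1, (hA a ha b hb.1).resolve_left hb.2⟩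
    · simp only [Unsplit, not_forall] at hun
      obtain ⟨U, hU, ⟨c, hcA, hcU⟩, hnot⟩ := hun
      obtain ⟨d, hdA, hdU⟩ := Finset.not_subset.1 hnot
      have h₁ := ih (A ∩ U) (Finset.ssubset_iff_subset_ne.2 ⟨Finset.inter_subset_left, fun h =>
          hdU (Finset.mem_inter.1 (h ▸ hdA)).2⟩) (hAS.mono_left Finset.inter_subset_left)
        fun a ha b hab => by
          rw [Finset.mem_inter] at ha ⊢
          exact (hA a ha.1 b hab).imp_left fun hb => ⟨hb, hU a ha.1 b hb hab ha.2⟩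
      have h₂ := ih (A \ U) (Finset.ssubset_iff_subset_ne.2 ⟨Finset.sdiff_subset, fun h =>
          (Finset.mem_sdiff.1 (h ▸ hcA)).2 hcU⟩) (hAS.mono_left Finset.sdiff_subset)
        fun a ha b hab => by
          rw [Finset.mem_sdiff] at ha ⊢
          exact (hA a ha.1 b hab).imp_left fun hb =>
            ⟨hb, fun hbU => ha.2 (hU b hb a ha.1 hab.symm hbU)⟩
      have hcard : ((A ∩ U).card : ℝ) + (A \ U).card = A.card := by
        exact_mod_cast Finset.card_inter_add_card_sdiff A U
      rw [← hcard, mul_add, ← Finset.sum_inter_add_sum_sdiff A U]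
      exact add_le_add h₁ h₂

/-- In a `k`-regular graph, a set whose removal leaves only components of at most half of the
vertices has at least `h(G)/k` times as many vertices as its complement. -/
lemma cheeger_mul_card_sub_le {k : ℕ} (hreg : G.IsRegularOfDegree k) {S : Finset V}
    (hS : ∀ B : Finset V, Unsplit G B → Disjoint B S → 2 * B.card ≤ Fintype.card V) :
    cheeger G * (Fintype.card V - S.card) ≤ k * S.card := by
  have h := cheeger_mul_card_le_sum_inter G hS Sᶜ disjoint_compl_left fun a _ b _ => by
    simpa using (em (b ∈ S)).symm
  have hcard : ((Sᶜ.card : ℕ) : ℝ) = Fintype.card V - S.card := by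
    rw [Finset.card_compl, Nat.cast_sub S.card_le_univ]
  have hcount : ∑ a ∈ Sᶜ, (G.neighborFinset a ∩ S).card ≤ k * S.card := by
    calc ∑ a ∈ Sᶜ, (G.neighborFinset a ∩ S).card
        = ∑ b ∈ S, (G.neighborFinset b ∩ Sᶜ).card := by
          simp only [Finset.card_eq_sum_ones]
          exact Finset.sum_comm' fun a b => by
            simp only [Finset.mem_inter, mem_neighborFinset, G.adj_comm]
            tauto
      _ ≤ ∑ b ∈ S, k := Finset.sum_le_sum fun b _ =>
          (Finset.card_le_card Finset.inter_subset_left).trans_eq (hreg b)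
      _ = k * S.card := by rw [Finset.sum_const, smul_eq_mul, mul_comm]
  rw [hcard] at h
  exact h.trans (by exact_mod_cast hcount)

end Cheeger

section MajoritySet

variable [Fintype V] (G : SimpleGraph V)

/-- `B` is an unsplit set of more than half of the vertices carrying no chip of `D`. -/
def IsMajority (D : V → ℤ) (B : Finset V) : Prop :=
  Unsplit G B ∧ (∀ b ∈ B, D b ≤ 0) ∧ Fintype.card V < 2 * B.card

variable {G} [DecidableEq V]

lemma IsMajority.exists_mem_mem {D D' : V → ℤ} {B B' : Finset V} (h : IsMajority G D B)
    (h' : IsMajority G D' B') : ∃ a ∈ B, a ∈ B' := by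
  by_contra! hdis
  have := (Finset.card_union_of_disjoint (Finset.disjoint_left.2 hdis)).symm.trans_le
    (Finset.card_le_univ _)
  have := h.2.2
  have := h'.2.2
  omega

variable [DecidableRel G.Adj]

/-- A legal set-firing that does not contain a maximal majority set `B` only shrinks it. -/
lemma IsMajority.subset_of_fire {D : V → ℤ} {B B' U : Finset V} {v : V}
    (hD : Effective D) (hD' : Effective (D - lapply G (fire U))) (hB : IsMajority G D B)
    (hmax : ∀ A, IsMajority G D A → A.card ≤ B.card)
    (hB' : IsMajority G (D - lapply G (fire U)) B') (hv : v ∈ B) (hvU : v ∉ U) : B' ⊆ B := by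
  obtain ⟨c, hcB, hcB'⟩ := hB.exists_mem_mem hB'
  have hBU : ∀ a ∈ B, a ∉ U := fun a ha haU => by
    refine hvU (hB.1 U (fun a ha b hb hab haU => ?_) ⟨a, ha, haU⟩ hv)
    by_contra hbU
    have h₁ := one_le_lapply_fire G hab haU hbU
    have h₂ := hB.2.1 a ha
    have h₃ := hD' a
    rw [Pi.sub_apply] at h₃
    omega
  have hBU' : ∀ a ∈ B', a ∉ U := fun a ha haU => by
    refine hBU c hcB (hB'.1 U (fun a ha b hb hab haU => ?_) ⟨a, ha, haU⟩ hcB')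
    by_contra hbU
    have h₁ := lapply_fire_le_neg_one G hab haU hbU
    have h₂ := hB'.2.1 b hb
    have h₃ := hD b
    rw [Pi.sub_apply] at h₂
    omega
  have hunion : IsMajority G D (B ∪ B') := by
    refine ⟨hB.1.union hB'.1 ⟨c, hcB, hcB'⟩, fun b hb => ?_,
      hB.2.2.trans_le (Nat.mul_le_mul_left 2 (Finset.card_le_card Finset.subset_union_left))⟩
    rcases Finset.mem_union.1 hb with hb | hb
    · exact hB.2.1 b hb
    · have h₁ := lapply_fire_nonpos G (hBU' b hb)
      have h₂ := hB'.2.1 b hb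
      rw [Pi.sub_apply] at h₂
      omega
  rw [Finset.eq_of_subset_of_card_le Finset.subset_union_left (hmax _ hunion)]
  exact Finset.subset_union_right

/-- If all effective divisors of a class have majority sets, and `B` is a smallest among the
largest majority sets, then no chip can be moved into `B`. -/
lemma not_one_le_of_isMajority {P : (V → ℤ) → Prop}
    (hP : ∀ D x, P D → Effective (D - lapply G x) → P (D - lapply G x))
    (heff : ∀ D, P D → Effective D)
    (hex : ∀ D, P D → ∃ B, IsMajority G D B ∧ ∀ A, IsMajority G D A → A.card ≤ B.card)
    {B : Finset V} {v : V} (hv : v ∈ B)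
    (hmin : ∀ D A, P D → IsMajority G D A → (∀ A', IsMajority G D A' → A'.card ≤ A.card) →
      B.card ≤ A.card)
    (N : ℕ) (D x : V → ℤ) (hD : P D) (hB : IsMajority G D B)
    (hmax : ∀ A, IsMajority G D A → A.card ≤ B.card) (hx : ∀ w, x w ≤ x v + N)
    (hE : Effective (D - lapply G x)) : ¬ 1 ≤ (D - lapply G x) v := by
  induction N generalizing D x with
  | zero =>
    have h₁ : 0 ≤ lapply G x v := by
      rw [lapply_eq_sum_sub]
      exact Finset.sum_nonneg fun w _ => by simpa using hx w
    have h₂ := hB.2.1 v hv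
    rw [Pi.sub_apply]
    omega
  | succ N ih =>
    push_cast at hx
    set U : Finset V := Finset.univ.filter fun w => x w = x v + N + 1 with hUdef
    have hmem : ∀ w, w ∈ U ↔ x w = x v + N + 1 := fun w => by simp [hUdef]
    have hvU : v ∉ U := by rw [hmem]; omega
    have hD' : Effective (D - lapply G (fire U)) := fun w => by
      rw [Pi.sub_apply]
      have h₀ := heff D hD w
      by_cases hw : w ∈ U
      · have hwx := (hmem w).1 hw
        have h₁ := lapply_fire_le G (x := x) hw (fun u => by have := hx u; omega)
          (fun u hu => by have := hx u; rw [hmem] at hu; omega)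
        have h₂ := hE w
        rw [Pi.sub_apply] at h₂
        omega
      · have := lapply_fire_nonpos G hw
        omega
    have hPD' := hP D _ hD hD'
    obtain ⟨B', hB', hmax'⟩ := hex _ hPD'
    obtain rfl : B' = B := Finset.eq_of_subset_of_card_le
      (hB.subset_of_fire (heff D hD) hD' hmax hB' hv hvU) (hmin _ _ hPD' hB' hmax')
    have heq : D - lapply G (fire U) - lapply G (x - fire U) = D - lapply G x := by
      rw [lapply_sub]
      abel
    rw [← heq] at hE ⊢
    refine ih _ _ hPD' hB' hmax' (fun w => ?_) hE
    have h₁ := hx w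
    have h₂ := hmem w
    simp only [Pi.sub_apply, fire, hvU, if_false]
    split_ifs with hw
    · omega
    · have := mt h₂.2 hw
      omega

/-- A class of positive rank contains an effective divisor without majority sets. -/
lemma PosRank.exists_effective_forall_not_isMajority [Nonempty V] {D : V → ℤ}
    (hD : PosRank G D) :
    ∃ x, Effective (D - lapply G x) ∧ ∀ B, ¬ IsMajority G (D - lapply G x) B := by
  have hreach : ∀ v, ∃ y, Effective (D - lapply G y) ∧ 1 ≤ (D - lapply G y) v := fun v => by
    obtain ⟨E, hE, y, hy⟩ := hD v
    have hval : ∀ w, (D - lapply G y) w = E w + if w = v then 1 else 0 := fun w => by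
      have := congrFun hy w
      simp only [Pi.sub_apply] at this ⊢
      omega
    refine ⟨y, fun w => ?_, ?_⟩
    · rw [hval]
      have := hE w
      split_ifs <;> omega
    · rw [hval, if_pos rfl]
      have := hE v
      omega
  by_contra! hall
  let P : (V → ℤ) → Prop := fun D' => Effective D' ∧ ∃ x, D' = D - lapply G x
  have hex : ∀ D', P D' →
      ∃ B, IsMajority G D' B ∧ ∀ A, IsMajority G D' A → A.card ≤ B.card := by
    rintro _ ⟨hD', x, rfl⟩
    exact Set.exists_max_image {B | IsMajority G (D - lapply G x) B} Finset.card
      (Set.toFinite _) (hall x hD')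
  let T : Set (Finset V) := {B | ∃ D', P D' ∧ IsMajority G D' B ∧
    ∀ A, IsMajority G D' A → A.card ≤ B.card}
  have hT : T.Nonempty := by
    obtain ⟨y, hy, -⟩ := hreach (Classical.arbitrary V)
    obtain ⟨B, hB⟩ := hex _ ⟨hy, y, rfl⟩
    exact ⟨B, _, ⟨hy, y, rfl⟩, hB⟩
  obtain ⟨B, ⟨D', hPD', hB, hmax⟩, hmin⟩ :=
    Set.exists_min_image T Finset.card (Set.toFinite _) hT
  obtain ⟨v, hv⟩ : B.Nonempty := Finset.card_pos.1 (by have := hB.2.2; omega)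
  obtain ⟨y, hy, hyv⟩ := hreach v
  obtain ⟨x, rfl⟩ := hPD'.2
  have heq : D - lapply G y = D - lapply G x - lapply G (y - x) := by
    rw [lapply_sub]
    abel
  rw [heq] at hy hyv
  obtain ⟨m, hm⟩ := Finite.bddAbove_range (y - x)
  refine not_one_le_of_isMajority (P := P) ?_ (fun _ h => h.1) hex hv
    (fun D'' A h₁ h₂ h₃ => hmin A ⟨D'', h₁, h₂, h₃⟩) (m - (y - x) v).toNat _ (y - x) hPD' hB hmax
    (fun w => ?_) hy hyv
  · rintro _ z ⟨-, x', rfl⟩ hz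
    exact ⟨hz, x' + z, by rw [lapply_add]; abel⟩
  · have := hm (Set.mem_range_self w)
    omega

end MajoritySet

lemma PosRank.cheeger_mul_card_le [Fintype V] [DecidableEq V] {G : SimpleGraph V}
    [DecidableRel G.Adj] [Nonempty V] {k : ℕ} (hreg : G.IsRegularOfDegree k) {D : V → ℤ}
    (hD : PosRank G D) :
    0 ≤ degD D ∧ cheeger G * Fintype.card V ≤ (k + cheeger G) * degD D := by
  obtain ⟨x, heff, hmaj⟩ := hD.exists_effective_forall_not_isMajority
  set D' := D - lapply G x with hD'
  have hdeg : degD D' = degD D := by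
    have := degD_lapply G x
    simp only [degD, hD', Pi.sub_apply, Finset.sum_sub_distrib] at this ⊢
    omega
  set S : Finset V := Finset.univ.filter fun v => 0 < D' v with hS
  have hcard : (S.card : ℤ) ≤ degD D := by
    rw [← hdeg, degD, hS, Finset.card_filter]
    push_cast
    refine Finset.sum_le_sum fun v _ => ?_
    have := heff v
    split_ifs <;> omega
  have h := cheeger_mul_card_sub_le G hreg (S := S) fun B hB hBS => by
    by_contra! hlt
    refine hmaj B ⟨hB, fun b hb => ?_, hlt⟩
    have := Finset.disjoint_left.1 hBS hb
    simpa [hS] using this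
  have hcard' : (S.card : ℝ) ≤ degD D := by exact_mod_cast hcard
  have hh := cheeger_nonneg G
  have hk : (0 : ℝ) ≤ k := k.cast_nonneg
  refine ⟨(Int.natCast_nonneg _).trans hcard, ?_⟩
  calc cheeger G * Fintype.card V ≤ (k + cheeger G) * S.card := by linarith
    _ ≤ _ := by gcongr

lemma posRank_one [Fintype V] [DecidableEq V] (G : SimpleGraph V) [DecidableRel G.Adj] :
    PosRank G fun _ => 1 := fun v =>
  ⟨fun w => 1 - if w = v then 1 else 0, fun w => by dsimp only; split_ifs <;> simp, 0, by ext; simp [lapply]⟩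

/-- For a `k`-regular finite connected simple graph `G` with `k ≥ 2`,
`gon(G) ≥ (h(G)/(k + h(G))) |V(G)|`. -/
theorem gonality_ge_cheeger {V : Type*} [Fintype V] [DecidableEq V]
    (G : SimpleGraph V) [DecidableRel G.Adj] (hG : G.Connected)
    (k : ℕ) (hk : 2 ≤ k) (hreg : G.IsRegularOfDegree k) :
    cheeger G / ((k : ℝ) + cheeger G) * (Fintype.card V : ℝ) ≤ (gonality G : ℝ) := by
  have : Nonempty V := hG.nonempty
  obtain ⟨D, hD, hdeg⟩ : gonality G ∈ {d : ℤ | ∃ D : V → ℤ, PosRank G D ∧ degD D = d} := by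
    refine Int.csInf_mem ⟨_, _, posRank_one G, rfl⟩ ⟨0, ?_⟩
    rintro _ ⟨D, hD, rfl⟩
    exact (hD.cheeger_mul_card_le hreg).1
  have h := (hD.cheeger_mul_card_le hreg).2
  have hpos : (0 : ℝ) < k + cheeger G :=
    add_pos_of_pos_of_nonneg (by exact_mod_cast two_pos.trans_le hk) (cheeger_nonneg G)
  rw [← hdeg, div_mul_eq_mul_div, div_le_iff₀ hpos, mul_comm (degD D : ℝ)]
  exact h

end GraphGonality
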